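/- Let t ≥ 2 and h be integers with 1 ≤ h < t, let m ≥ 6 be even, let M be a perfect matching of K_m, and let S be a set of vertices of K_m with |S| odd and |S| ≥ 5 containing four distinct vertices w_1, w_2, w_3, w_4 such that {w_1, w_2} ∈ M and {w_3, w_4} ∈ M. Then, writing s = |S|, there exist an (h,t)-uniform comb with handle H and teeth T_1, …, T_{s−2} on the vertex set of the t-subdivided prism G of K_m, and a Hamiltonian cycle T of G, such that |δ(H) ∩ E(T)| + Σ_{i=1}^{s−2} |δ(T_i) ∩ E(T)| − (3(s−2)+1) = |δ(S) ∩ M| − 1; that is, the slack of the comb inequality of (H; T_1,…,T_{s−2}) at the tour T equals the slack of the odd set inequality of S at the matching M. -/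

import Mathlib

open SimpleGraph Finset

attribute [local instance] Classical.propDecidable

/-- An edge `e` crosses the vertex set `S` if it has an endpoint in `S`
and an endpoint outside `S`. -/
def crossing {V : Type*} (S : Finset V) (e : Sym2 V) : Prop :=
  (∃ a ∈ e, a ∈ S) ∧ (∃ a ∈ e, a ∉ S)

/-- A comb with handle `H` and teeth `T 0, …, T (k-1)`. -/
def IsComb {V : Type*} [Fintype V] [DecidableEq V]
    (H : Finset V) {k : ℕ} (T : Fin k → Finset V) : Prop :=
  3 ≤ k ∧ Odd k ∧
  (∀ i j, i ≠ j → Disjoint (T i) (T j)) ∧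
  (∀ i, (H ∩ T i).Nonempty) ∧
  (H \ Finset.univ.biUnion T).Nonempty

/-- An `(h,t)`-uniform comb: every tooth has size `t` and meets the handle
in exactly `h` vertices. -/
def IsUniformComb {V : Type*} [Fintype V] [DecidableEq V] (h t : ℕ)
    (H : Finset V) {k : ℕ} (T : Fin k → Finset V) : Prop :=
  IsComb H T ∧ ∀ i, (T i).card = t ∧ (H ∩ T i).card = h

/-- The `t`-subdivided prism over `K_m`: vertex `(i, j)` is the copy of
vertex `i` in layer `j` (layer `0` is the bottom, layer `t-1` the top).
There are complete graphs on the bottom and top layers, and vertical paths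
joining consecutive layers in each column. -/
def subPrism (m t : ℕ) : SimpleGraph (Fin m × Fin t) :=
  SimpleGraph.fromRel (fun p q =>
    (p.2.val = 0 ∧ q.2.val = 0 ∧ p.1 ≠ q.1) ∨
    (p.2.val = t - 1 ∧ q.2.val = t - 1 ∧ p.1 ≠ q.1) ∨
    (p.1 = q.1 ∧ p.2.val + 1 = q.2.val))

/-- A perfect matching of `K_m`, given as a set of (non-loop) edges such that
every vertex belongs to exactly one of them. -/
def IsPerfectMatchingKm (m : ℕ) (M : Finset (Sym2 (Fin m))) : Prop :=
  (∀ e ∈ M, ¬ e.IsDiag) ∧ ∀ v : Fin m, ∃! e, e ∈ M ∧ v ∈ e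


noncomputable def ind {V : Type*} (X : Finset V) (p q : V) : ℕ := if (p ∈ X ↔ q ∈ X) then 0 else 1

theorem ind_symm {V : Type*} (X : Finset V) (p q : V) : ind X p q = ind X q p := by
  unfold ind; simp only [iff_comm]

theorem crossing_mk {V : Type*} (X : Finset V) (p q : V) :
    crossing X s(p, q) ↔ ¬ (p ∈ X ↔ q ∈ X) := by
  unfold crossing
  simp only [Sym2.mem_iff, exists_eq_or_imp, exists_eq_left]
  tauto

theorem exists_walk_seq {V : Type*} (G : SimpleGraph V) (f : ℕ → V) (N : ℕ)
    (hadj : ∀ k < N, G.Adj (f k) (f (k+1))) :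
    ∃ W : G.Walk (f 0) (f N), W.support = (List.range (N+1)).map f ∧
      W.edges = (List.range N).map (fun k => s(f k, f (k+1))) := by
  induction N with
  | zero => exact ⟨Walk.nil, by simp, by simp⟩
  | succ N ih =>
    obtain ⟨W, h1, h2⟩ := ih (fun k hk => hadj k (by omega))
    refine ⟨W.concat (hadj N (by omega)), ?_, ?_⟩
    · rw [Walk.support_concat, h1, List.range_succ (n := N+1)]; simp
    · rw [Walk.edges_concat, h2, List.range_succ (n := N)]; simp

theorem exists_ham_cycle {V : Type*} [Fintype V] [DecidableEq V] (G : SimpleGraph V) (f : ℕ → V) (N : ℕ)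
    (hN : 3 ≤ N) (hadj : ∀ k < N, G.Adj (f k) (f (k+1)))
    (hinj : ∀ k < N, ∀ l < N, f k = f l → k = l) (hsurj : ∀ v, ∃ k < N, f k = v)
    (hclosed : f N = f 0) :
    ∃ W : G.Walk (f 0) (f 0), W.IsHamiltonianCycle ∧ W.edges.Nodup ∧
      W.edges = (List.range N).map (fun k => s(f k, f (k+1))) := by
  obtain ⟨W, h1, h2⟩ := exists_walk_seq G f N hadj
  have hinj' : ∀ k ≤ N, ∀ l ≤ N, f k = f l → k = l ∨ (k = 0 ∧ l = N) ∨ (k = N ∧ l = 0) := by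
    intro k hk l hl h
    rcases Nat.lt_or_ge k N with hk' | hk'
    · rcases Nat.lt_or_ge l N with hl' | hl'
      · exact Or.inl (hinj k hk' l hl' h)
      · have : l = N := by omega
        subst this
        rw [hclosed] at h
        have := hinj k hk' 0 (by omega) h
        omega
    · have : k = N := by omega
      subst this
      rcases Nat.lt_or_ge l k with hl' | hl'
      · rw [hclosed] at h
        have := hinj 0 (by omega) l hl' h
        omega
      · omega
  have hnd : ((List.range N).map (fun k => s(f k, f (k+1)))).Nodup := by
    refine (List.nodup_map_iff_inj_on List.nodup_range).2 ?_
    intro k hk l hl h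
    rw [List.mem_range] at hk hl
    rw [Sym2.eq_iff] at h
    rcases h with ⟨h, _⟩ | ⟨ha, hb⟩
    · exact hinj k hk l hl h
    · have := hinj' _ (by omega) _ (by omega) ha
      have := hinj' _ (by omega) _ (by omega) hb
      omega
  have htail : W.support.tail = (List.range N).map (fun k => f (k+1)) := by
    rw [h1, List.range_succ_eq_map]; simp [Function.comp_def]
  have htnd : W.support.tail.Nodup := by
    rw [htail]
    refine (List.nodup_map_iff_inj_on List.nodup_range).2 ?_
    intro k hk l hl h
    rw [List.mem_range] at hk hl
    have := hinj' _ (by omega) _ (by omega) h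
    omega
  refine ⟨W.copy rfl hclosed, ?_, ?_, ?_⟩
  · rw [SimpleGraph.Walk.isHamiltonianCycle_iff_isCycle_and_support_count_tail_eq_one]
    refine ⟨?_, ?_⟩
    · rw [SimpleGraph.Walk.isCycle_def]
      refine ⟨⟨by rw [Walk.edges_copy, h2]; exact hnd⟩, ?_, by rw [Walk.support_copy]; exact htnd⟩
      intro h
      have h3 := congrArg Walk.edges h
      rw [Walk.edges_copy, h2] at h3
      have h4 := congrArg List.length h3
      simp at h4
      omega
    · intro v
      rw [Walk.support_copy]
      refine List.count_eq_one_of_mem htnd ?_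
      rw [htail, List.mem_map]
      obtain ⟨k, hk, rfl⟩ := hsurj v
      rcases Nat.eq_zero_or_pos k with rfl | hk0
      · exact ⟨N-1, by simp; omega, by rw [← hclosed]; congr 1; omega⟩
      · exact ⟨k-1, by simp; omega, by congr 1; omega⟩
  · rw [Walk.edges_copy, h2]; exact hnd
  · rw [Walk.edges_copy, h2]

theorem card_cross {V : Type*} [DecidableEq (Sym2 V)] (X : Finset V) (f : ℕ → V) (N : ℕ) (L : List (Sym2 V))
    (hL : L = (List.range N).map (fun k => s(f k, f (k+1)))) (hnd : L.Nodup) :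
    (L.toFinset.filter (crossing X)).card = ∑ k ∈ range N, ind X (f k) (f (k+1)) := by
  have h1 : L.toFinset = (range N).image (fun k => s(f k, f (k+1))) := by
    ext e; simp [hL]
  rw [h1, Finset.filter_image, Finset.card_image_of_injOn, Finset.card_filter]
  · refine Finset.sum_congr rfl fun k _ => ?_
    unfold ind
    simp only [crossing_mk]
    split_ifs <;> tauto
  · intro k hk l hl h
    rw [hL] at hnd
    refine (List.nodup_map_iff_inj_on List.nodup_range).1 hnd k ?_ l ?_ h <;> simp_all

theorem sum_range_mul' (F : ℕ → ℕ) (n w : ℕ) :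
    ∑ k ∈ range (n * w), F k = ∑ i ∈ range n, ∑ r ∈ range w, F (i * w + r) := by
  induction n with
  | zero => simp
  | succ n ih => rw [Nat.succ_mul, Finset.sum_range_add, ih, Finset.sum_range_succ]

def lay (u x : ℕ) : Fin (u+1) := ⟨min x u, by omega⟩

def tour {m : ℕ} (u : ℕ) (a b : ℕ → Fin m) (k : ℕ) : Fin m × Fin (u+1) :=
  if k % (2*u+2) < u + 1 then (a (k / (2*u+2)), lay u (u - k % (2*u+2)))
  else (b (k / (2*u+2)), lay u (k % (2*u+2) - (u+1)))

theorem tour1 {m : ℕ} (u : ℕ) (a b : ℕ → Fin m) (i r : ℕ) (hr : r ≤ u) :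
    tour u a b (i * (2*u+2) + r) = (a i, lay u (u-r)) := by
  have h1 : (i * (2*u+2) + r) % (2*u+2) = r := by
    rw [Nat.mul_add_mod_self_right, Nat.mod_eq_of_lt (by omega)]
  have h2 : (i * (2*u+2) + r) / (2*u+2) = i := by
    rw [Nat.add_comm, Nat.add_mul_div_right _ _ (by omega), Nat.div_eq_of_lt (by omega), Nat.zero_add]
  rw [tour, h1, h2, if_pos (by omega)]

theorem tour2 {m : ℕ} (u : ℕ) (a b : ℕ → Fin m) (i q : ℕ) (hq : q ≤ u) :
    tour u a b (i * (2*u+2) + (u + 1 + q)) = (b i, lay u q) := by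
  have h1 : (i * (2*u+2) + (u+1+q)) % (2*u+2) = u+1+q := by
    rw [Nat.mul_add_mod_self_right, Nat.mod_eq_of_lt (by omega)]
  have h2 : (i * (2*u+2) + (u+1+q)) / (2*u+2) = i := by
    rw [Nat.add_comm, Nat.add_mul_div_right _ _ (by omega), Nat.div_eq_of_lt (by omega), Nat.zero_add]
  rw [tour, h1, h2, if_neg (by omega), Nat.add_sub_cancel_left]

theorem tour3 {m : ℕ} (u : ℕ) (a b : ℕ → Fin m) (i : ℕ) :
    tour u a b (i * (2*u+2) + (2*u+2)) = (a (i+1), lay u u) := by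
  rw [show i * (2*u+2) + (2*u+2) = (i+1)*(2*u+2)+0 by ring, tour1 _ _ _ _ _ (by omega), Nat.sub_zero]

noncomputable def vert {m u : ℕ} (X : Finset (Fin m × Fin (u+1))) (c : Fin m) : ℕ :=
  ∑ q ∈ range u, ind X (c, lay u q) (c, lay u (q+1))

theorem count_tour {m u : ℕ} (X : Finset (Fin m × Fin (u+1))) (a b : ℕ → Fin m) (n : ℕ) :
    ∑ k ∈ range (n * (2*u+2)), ind X (tour u a b k) (tour u a b (k+1)) =
      ∑ i ∈ range n, (vert X (a i) + vert X (b i)) +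
      ∑ i ∈ range n, ind X (a i, lay u 0) (b i, lay u 0) +
      ∑ i ∈ range n, ind X (b i, lay u u) (a (i+1), lay u u) := by
  rw [sum_range_mul', ← Finset.sum_add_distrib, ← Finset.sum_add_distrib]
  refine Finset.sum_congr rfl fun i _ => ?_
  have hs : range (2*u+2) = range ((u + 1) + (u + 1)) := by congr 1; omega
  rw [hs, Finset.sum_range_add, Finset.sum_range_succ, Finset.sum_range_succ (n := u)]
  have e1 : ∑ r ∈ range u, ind X (tour u a b (i * (2*u+2) + r)) (tour u a b (i * (2*u+2) + r + 1))
      = vert X (a i) := by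
    rw [vert, ← Finset.sum_range_reflect]
    refine Finset.sum_congr rfl fun r hr => ?_
    rw [mem_range] at hr
    rw [tour1 _ _ _ _ _ (by omega), Nat.add_assoc, tour1 _ _ _ _ _ (by omega), ind_symm]
    congr 3 <;> omega
  have e2 : ∑ r ∈ range u, ind X (tour u a b (i * (2*u+2) + (u + 1 + r)))
      (tour u a b (i * (2*u+2) + (u + 1 + r) + 1)) = vert X (b i) := by
    rw [vert]
    refine Finset.sum_congr rfl fun r hr => ?_
    rw [mem_range] at hr
    rw [tour2 _ _ _ _ _ (by omega), Nat.add_assoc, Nat.add_assoc, tour2 _ _ _ _ _ (by omega)]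
  rw [e1, e2, tour1 _ _ _ _ _ le_rfl, tour2 _ _ _ _ _ le_rfl]
  rw [show i * (2*u+2) + u + 1 = i * (2*u+2) + (u + 1 + 0) by ring, tour2 _ _ _ _ _ (by omega)]
  rw [show i * (2*u+2) + (u + 1 + u) + 1 = i * (2*u+2) + (2*u+2) by ring, tour3, Nat.sub_self]
  ring

structure Enum {m : ℕ} (n : ℕ) (a b : ℕ → Fin m) : Prop where
  an : a n = a 0
  n2 : 2 ≤ n
  ainj : ∀ i < n, ∀ j < n, a i = a j → i = j
  binj : ∀ i < n, ∀ j < n, b i = b j → i = j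
  ab : ∀ i < n, ∀ j < n, a i ≠ b j
  surj : ∀ v, (∃ i < n, a i = v) ∨ (∃ i < n, b i = v)

theorem Enum.sum_eq {m n : ℕ} {a b : ℕ → Fin m} (E : Enum n a b) (g : Fin m → ℕ) :
    ∑ i ∈ range n, (g (a i) + g (b i)) = ∑ c, g c := by
  have hu : (univ : Finset (Fin m)) = (range n).image a ∪ (range n).image b := by
    ext v
    have := E.surj v
    simpa using this
  rw [hu, Finset.sum_union, Finset.sum_image, Finset.sum_image, Finset.sum_add_distrib]
  · intro i hi j hj; exact E.binj i (by simpa using hi) j (by simpa using hj)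
  · intro i hi j hj; exact E.ainj i (by simpa using hi) j (by simpa using hj)
  · rw [Finset.disjoint_left]
    simp only [Finset.mem_image, mem_range]
    rintro v ⟨i, hi, rfl⟩ ⟨j, hj, h⟩
    exact E.ab i hi j hj h.symm

theorem Enum.shift {m n : ℕ} {a b : ℕ → Fin m} (E : Enum n a b) (g : Fin m → ℕ) :
    ∑ i ∈ range n, (g (b i) + g (a (i+1))) = ∑ c, g c := by
  rw [← E.sum_eq, Finset.sum_add_distrib, Finset.sum_add_distrib, Nat.add_comm]
  congr 1
  have h1 := Finset.sum_range_succ (fun i => g (a i)) n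
  have h2 := Finset.sum_range_succ' (fun i => g (a i)) n
  simp only [E.an] at h1
  omega

theorem lay_inj {u x y : ℕ} (hx : x ≤ u) (hy : y ≤ u) (h : lay u x = lay u y) : x = y := by
  have := congrArg Fin.val h
  simp only [lay] at this
  omega

theorem tour_decomp (u k n : ℕ) (hk : k < n * (2*u+2)) :
    ∃ i < n, (∃ r ≤ u, k = i * (2*u+2) + r) ∨ (∃ q ≤ u, k = i * (2*u+2) + (u+1+q)) := by
  refine ⟨k / (2*u+2), (Nat.div_lt_iff_lt_mul (by omega)).2 hk, ?_⟩
  have h1 := Nat.div_add_mod' k (2*u+2)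
  have h2 := Nat.mod_lt k (show 0 < 2*u+2 by omega)
  rcases Nat.lt_or_ge (k % (2*u+2)) (u+1) with h | h
  · exact Or.inl ⟨k % (2*u+2), by omega, h1.symm⟩
  · exact Or.inr ⟨k % (2*u+2) - (u+1), by omega, by rw [Nat.add_sub_cancel' h]; exact h1.symm⟩

theorem Enum.ham {m n u : ℕ} (hu : 1 ≤ u) {a b : ℕ → Fin m} (E : Enum n a b) :
    ∃ W : (subPrism m (u+1)).Walk (tour u a b 0) (tour u a b 0), W.IsHamiltonianCycle ∧ W.edges.Nodup ∧
      W.edges = (List.range (n * (2*u+2))).map (fun k => s(tour u a b k, tour u a b (k+1))) := by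
  have hn := E.n2
  apply exists_ham_cycle
  · nlinarith
  · intro k hk
    obtain ⟨i, hi, ⟨r, hr, rfl⟩ | ⟨q, hq, rfl⟩⟩ := tour_decomp u k n hk
    · rw [tour1 _ _ _ _ _ hr]
      rcases Nat.lt_or_ge r u with h | h
      · rw [Nat.add_assoc, tour1 _ _ _ _ _ (by omega)]
        simp only [subPrism, SimpleGraph.fromRel_adj]
        refine ⟨?_, Or.inr (Or.inr (Or.inr ⟨by trivial, ?_⟩))⟩
        · intro h'
          have := lay_inj (by omega) (by omega) (congrArg Prod.snd h')
          omega
        · simp only [lay]; omega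
      · have : r = u := by omega
        subst this
        rw [show i * (2*r+2) + r + 1 = i * (2*r+2) + (r + 1 + 0) by ring, tour2 _ _ _ _ _ (by omega)]
        have := E.ab i hi i hi
        simp only [subPrism, SimpleGraph.fromRel_adj]
        refine ⟨fun h' => this (congrArg Prod.fst h'), Or.inl (Or.inl ⟨?_, ?_, this⟩)⟩ <;> simp [lay]
    · rw [tour2 _ _ _ _ _ hq]
      rcases Nat.lt_or_ge q u with h | h
      · rw [Nat.add_assoc, Nat.add_assoc, tour2 _ _ _ _ _ (by omega)]
        simp only [subPrism, SimpleGraph.fromRel_adj]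
        refine ⟨?_, Or.inl (Or.inr (Or.inr ⟨by trivial, ?_⟩))⟩
        · intro h'
          have := lay_inj (by omega) (by omega) (congrArg Prod.snd h')
          omega
        · simp only [lay]; omega
      · have : q = u := by omega
        subst this
        rw [show i * (2*q+2) + (q + 1 + q) + 1 = i * (2*q+2) + (2*q+2) by ring, tour3]
        have : b i ≠ a (i+1) := by
          rcases Nat.lt_or_ge (i+1) n with h' | h'
          · exact (E.ab _ h' i hi).symm
          · rw [show i + 1 = n by omega, E.an]
            exact (E.ab 0 (by omega) i hi).symm
        simp only [subPrism, SimpleGraph.fromRel_adj]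
        refine ⟨fun h' => this (congrArg Prod.fst h'), Or.inl (Or.inr (Or.inl ⟨?_, ?_, this⟩))⟩ <;> simp [lay]
  · intro k hk l hl h
    obtain ⟨i, hi, ⟨r, hr, rfl⟩ | ⟨q, hq, rfl⟩⟩ := tour_decomp u k n hk <;>
    obtain ⟨j, hj, ⟨r', hr', rfl⟩ | ⟨q', hq', rfl⟩⟩ := tour_decomp u l n hl
    · rw [tour1 _ _ _ _ _ hr, tour1 _ _ _ _ _ hr', Prod.mk.injEq] at h
      have h1 := E.ainj _ hi _ hj h.1
      have h2 := lay_inj (by omega) (by omega) h.2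
      subst h1
      omega
    · rw [tour1 _ _ _ _ _ hr, tour2 _ _ _ _ _ hq', Prod.mk.injEq] at h
      exact absurd h.1 (E.ab _ hi _ hj)
    · rw [tour2 _ _ _ _ _ hq, tour1 _ _ _ _ _ hr', Prod.mk.injEq] at h
      exact absurd h.1.symm (E.ab _ hj _ hi)
    · rw [tour2 _ _ _ _ _ hq, tour2 _ _ _ _ _ hq', Prod.mk.injEq] at h
      have h1 := E.binj _ hi _ hj h.1
      have h2 := lay_inj (by omega) (by omega) h.2
      subst h1
      omega
  · rintro ⟨c, x⟩
    have hx := x.2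
    rcases E.surj c with ⟨i, hi, rfl⟩ | ⟨i, hi, rfl⟩
    · refine ⟨i * (2*u+2) + (u - x.1), ?_, ?_⟩
      · have : (i+1) * (2*u+2) ≤ n * (2*u+2) := Nat.mul_le_mul_right _ hi
        have h3 : (i+1) * (2*u+2) = i * (2*u+2) + (2*u+2) := by ring
        omega
      · rw [tour1 _ _ _ _ _ (by omega)]
        congr 1
        apply Fin.ext
        simp only [lay]; omega
    · refine ⟨i * (2*u+2) + (u + 1 + x.1), ?_, ?_⟩
      · have : (i+1) * (2*u+2) ≤ n * (2*u+2) := Nat.mul_le_mul_right _ hi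
        have h3 : (i+1) * (2*u+2) = i * (2*u+2) + (2*u+2) := by ring
        omega
      · rw [tour2 _ _ _ _ _ (by omega)]
        congr 1
        apply Fin.ext
        simp only [lay]; omega
  · have h1 := tour1 u a b n 0 (by omega)
    have h2 := tour1 u a b 0 0 (by omega)
    rw [Nat.add_zero (n * (2*u+2))] at h1
    rw [Nat.zero_mul, Nat.add_zero 0] at h2
    rw [h1, h2, E.an]

theorem exists_enum {m : ℕ} (M : Finset (Sym2 (Fin m))) (hM : IsPerfectMatchingKm m M)
    (w₁ w₂ w₃ w₄ : Fin m)
    (hdist : w₁ ≠ w₂ ∧ w₁ ≠ w₃ ∧ w₁ ≠ w₄ ∧ w₂ ≠ w₃ ∧ w₂ ≠ w₄ ∧ w₃ ≠ w₄)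
    (h12 : s(w₁, w₂) ∈ M) (h34 : s(w₃, w₄) ∈ M) :
    ∃ (n : ℕ) (a b : ℕ → Fin m), Enum n a b ∧ a 0 = w₂ ∧ b 0 = w₁ ∧ a 1 = w₃ ∧ b 1 = w₄ ∧
      (∀ e, e ∈ M ↔ ∃ i < n, s(a i, b i) = e) ∧
      (∀ i < n, ∀ j < n, s(a i, b i) = s(a j, b j) → i = j) := by
  obtain ⟨hnd, huniq⟩ := hM
  have hne : s(w₁, w₂) ≠ s(w₃, w₄) := by
    rw [Ne, Sym2.eq_iff]; tauto
  set R := (M.erase s(w₁, w₂)).erase s(w₃, w₄) with hR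
  have hmemR : ∀ e, e ∈ R ↔ e ≠ s(w₃, w₄) ∧ e ≠ s(w₁, w₂) ∧ e ∈ M := by
    intro e; simp [hR]
  let L : List (Fin m × Fin m) := (w₂, w₁) :: (w₃, w₄) :: R.toList.map Quot.out
  have hout : ∀ e : Sym2 (Fin m), s((Quot.out e).1, (Quot.out e).2) = e := fun e => Quot.out_eq e
  have hLmap : L.map (fun p => s(p.1, p.2)) = s(w₁, w₂) :: s(w₃, w₄) :: R.toList := by
    simp only [L, List.map_cons, List.map_map]
    rw [Sym2.eq_swap]
    congr 2
    conv_rhs => rw [← List.map_id R.toList]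
    exact List.map_congr_left fun e _ => hout e
  have hLnd : (L.map (fun p => s(p.1, p.2))).Nodup := by
    rw [hLmap]
    simp [hmemR, hne, Finset.nodup_toList]
  have hLmem : ∀ e, e ∈ M ↔ e ∈ L.map (fun p => s(p.1, p.2)) := by
    intro e
    rw [hLmap]
    simp only [List.mem_cons, Finset.mem_toList, hmemR]
    by_cases h1 : e = s(w₁, w₂)
    · subst h1; simpa using h12
    · by_cases h2 : e = s(w₃, w₄)
      · subst h2; simpa using h34
      · simp [h1, h2]
  have hlen : 2 ≤ L.length := by simp [L]
  let a : ℕ → Fin m := fun i => (L.getD i (w₂, w₁)).1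
  let b : ℕ → Fin m := fun i => (L.getD i (w₂, w₁)).2
  have hget : ∀ i, ∀ hi : i < L.length, s(a i, b i) = (L.map (fun p => s(p.1, p.2)))[i]'(by simpa using hi) := by
    intro i hi
    simp [a, b, List.getD_eq_getElem, hi]
  have hsurjM : ∀ e, e ∈ M ↔ ∃ i < L.length, s(a i, b i) = e := by
    intro e
    rw [hLmem, List.mem_iff_getElem]
    constructor
    · rintro ⟨i, hi, h⟩
      have hi' : i < L.length := by simpa using hi
      exact ⟨i, hi', by rw [hget i hi', h]⟩
    · rintro ⟨i, hi, h⟩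
      exact ⟨i, by simpa using hi, by rw [← hget i hi, h]⟩
  have hinjM : ∀ i < L.length, ∀ j < L.length, s(a i, b i) = s(a j, b j) → i = j := by
    intro i hi j hj h
    rw [hget i hi, hget j hj] at h
    exact (List.Nodup.getElem_inj_iff hLnd).1 h
  have hM' : ∀ i < L.length, s(a i, b i) ∈ M := fun i hi => (hsurjM _).2 ⟨i, hi, rfl⟩
  have hcommon : ∀ i < L.length, ∀ j < L.length, ∀ v, v ∈ s(a i, b i) → v ∈ s(a j, b j) → i = j := by
    intro i hi j hj v h1 h2
    exact hinjM i hi j hj ((huniq v).unique ⟨hM' i hi, h1⟩ ⟨hM' j hj, h2⟩)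
  refine ⟨L.length, a, b, ⟨?_, hlen, ?_, ?_, ?_, ?_⟩, by simp [a, L], by simp [b, L], by simp [a, L],
    by simp [b, L], hsurjM, hinjM⟩
  · have h1 : a L.length = w₂ := by simp [a]
    rw [h1]; simp [a, L]
  · intro i hi j hj h
    exact hcommon i hi j hj (a i) (by simp) (by simp [h])
  · intro i hi j hj h
    exact hcommon i hi j hj (b i) (by simp) (by simp [h])
  · intro i hi j hj h
    have := hcommon i hi j hj (a i) (by simp) (by simp [h])
    subst this
    exact hnd _ (hM' i hi) (by simpa using h)
  · intro v
    obtain ⟨e, ⟨he, hv⟩, _⟩ := huniq v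
    obtain ⟨i, hi, rfl⟩ := (hsurjM e).1 he
    rw [Sym2.mem_iff] at hv
    rcases hv with rfl | rfl
    · exact Or.inl ⟨i, hi, rfl⟩
    · exact Or.inr ⟨i, hi, rfl⟩

/-- Number of crossings of a full column. -/
theorem count_col {m n u : ℕ} {a b : ℕ → Fin m} (E : Enum n a b) (c : Fin m)
    (X : Finset (Fin m × Fin (u+1))) (hX : ∀ p, p ∈ X ↔ p.1 = c) :
    ∑ k ∈ range (n * (2*u+2)), ind X (tour u a b k) (tour u a b (k+1)) = 2 := by
  have hn := E.n2
  have hone : ∑ x : Fin m, (if x = c then 1 else 0) = 1 := by simp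
  have key : ∀ x y : Fin m, ∀ q, x ≠ y →
      ind X (x, lay u q) (y, lay u q) = (if x = c then 1 else 0) + (if y = c then 1 else 0) := by
    intro x y q hxy
    simp only [ind, hX]
    by_cases h1 : x = c <;> by_cases h2 : y = c <;> simp_all
  have e1 : ∀ c', vert X c' = 0 := by
    intro c'
    simp [vert, ind, hX]
  have e2 : ∑ i ∈ range n, ind X (a i, lay u 0) (b i, lay u 0) = 1 := by
    refine Eq.trans ?_ ((E.sum_eq _).trans hone)
    refine Finset.sum_congr rfl fun i hi => key _ _ _ ?_
    rw [mem_range] at hi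
    exact E.ab i hi i hi
  have e3 : ∑ i ∈ range n, ind X (b i, lay u u) (a (i+1), lay u u) = 1 := by
    refine Eq.trans ?_ ((E.shift _).trans hone)
    refine Finset.sum_congr rfl fun i hi => key _ _ _ ?_
    rw [mem_range] at hi
    rcases Nat.lt_or_ge (i+1) n with h' | h'
    · exact (E.ab _ h' i hi).symm
    · rw [show i + 1 = n by omega, E.an]
      exact (E.ab 0 (by omega) i hi).symm
  rw [count_tour, e2, e3]
  simp [e1]

theorem count_handle {m n u h : ℕ} (hh : 1 ≤ h) (hhu : h ≤ u) {a b : ℕ → Fin m} (E : Enum n a b)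
    (S S' : Finset (Fin m)) (w₁ w₃ : Fin m) (hS' : ∀ c, c ∈ S' ↔ c ∈ S ∧ c ≠ w₁ ∧ c ≠ w₃)
    (hw1 : w₁ ∈ S) (hw3 : w₃ ∈ S) (hb0 : b 0 = w₁) (ha1 : a 1 = w₃)
    (X : Finset (Fin m × Fin (u+1)))
    (hX : ∀ p, p ∈ X ↔ (p.1 ∈ S ∧ p.2.val < h) ∨ p.1 = w₁ ∨ p.1 = w₃) :
    ∑ k ∈ range (n * (2*u+2)), ind X (tour u a b k) (tour u a b (k+1)) =
      S'.card + ∑ i ∈ range n, ind S (a i) (b i) := by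
  have hn := E.n2
  have e1 : ∀ c, vert X c = if c ∈ S' then 1 else 0 := by
    intro c
    rw [vert]
    split_ifs with hc
    · rw [hS'] at hc
      rw [Finset.sum_eq_single (h-1)]
      · simp only [ind, hX, lay, hc, true_and, or_false]
        rw [if_neg]
        omega
      · intro q hq hne
        rw [mem_range] at hq
        simp only [ind, hX, lay, hc, true_and, or_false]
        rw [if_pos]
        omega
      · intro h'
        rw [mem_range] at h'
        omega
    · refine Finset.sum_eq_zero fun q _ => ?_
      rw [hS'] at hc
      simp only [ind, hX]
      rw [if_pos]
      by_cases h1 : c ∈ S <;> by_cases h2 : c = w₁ <;> by_cases h3 : c = w₃ <;> simp_all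
  have e2 : ∀ i, ind X (a i, lay u 0) (b i, lay u 0) = ind S (a i) (b i) := by
    intro i
    have : ∀ c, (c, lay u 0) ∈ X ↔ c ∈ S := by
      intro c
      simp only [hX, lay]
      constructor
      · rintro (h' | rfl | rfl)
        · exact h'.1
        · exact hw1
        · exact hw3
      · intro h'
        exact Or.inl ⟨h', by omega⟩
    simp only [ind, this]
    congr
  have e3 : ∀ i ∈ range n, ind X (b i, lay u u) (a (i+1), lay u u) = 0 := by
    intro i hi
    rw [mem_range] at hi
    have : ∀ c, (c, lay u u) ∈ X ↔ c = w₁ ∨ c = w₃ := by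
      intro c
      simp only [hX, lay]
      have : ¬ (min u u < h) := by omega
      simp [hhu]
    simp only [ind, this]
    rw [if_pos]
    subst hb0 ha1
    have h0 : b i = b 0 ↔ i = 0 := ⟨E.binj i hi 0 (by omega), fun h => by rw [h]⟩
    have h1 : b i ≠ a 1 := (E.ab 1 (by omega) i hi).symm
    rcases Nat.lt_or_ge (i+1) n with h' | h'
    · have h2 : a (i+1) ≠ b 0 := E.ab _ h' 0 (by omega)
      have h3 : a (i+1) = a 1 ↔ i = 0 := ⟨fun h => by have := E.ainj _ h' 1 (by omega) h; omega, fun h => by rw [h]⟩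
      tauto
    · have h4 : i + 1 = n := by omega
      rw [h4, E.an]
      have h2 : a 0 ≠ b 0 := E.ab 0 (by omega) 0 (by omega)
      have h3 : a 0 ≠ a 1 := fun h => by have := E.ainj 0 (by omega) 1 (by omega) h; omega
      have h5 : i ≠ 0 := by omega
      tauto
  rw [count_tour, Finset.sum_eq_zero e3, Finset.sum_congr rfl fun i _ => e2 i, E.sum_eq]
  simp [e1]

theorem card_matching {m n : ℕ} (M : Finset (Sym2 (Fin m))) (S : Finset (Fin m)) (a b : ℕ → Fin m)
    (h1 : ∀ e, e ∈ M ↔ ∃ i < n, s(a i, b i) = e)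
    (h2 : ∀ i < n, ∀ j < n, s(a i, b i) = s(a j, b j) → i = j) :
    (M.filter (crossing S)).card = ∑ i ∈ range n, ind S (a i) (b i) := by
  have h3 : M = (range n).image (fun k => s(a k, b k)) := by
    ext e; simp [h1]
  rw [h3, Finset.filter_image, Finset.card_image_of_injOn, Finset.card_filter]
  · refine Finset.sum_congr rfl fun k _ => ?_
    unfold ind
    simp only [crossing_mk]
    split_ifs <;> tauto
  · intro k hk l hl h
    refine h2 k ?_ l ?_ h <;> simp_all

theorem card_col {m u h : ℕ} (hh : h ≤ u + 1) (c : Fin m) (X : Finset (Fin m × Fin (u+1)))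
    (hX : ∀ p, p ∈ X ↔ p.1 = c ∧ p.2.val < h) : X.card = h := by
  have : X = (range h).image (fun q => (c, lay u q)) := by
    ext ⟨d, q⟩
    simp only [hX, Finset.mem_image, mem_range, Prod.mk.injEq]
    constructor
    · rintro ⟨rfl, hq⟩
      exact ⟨q.val, hq, rfl, Fin.ext (by simp only [lay]; omega)⟩
    · rintro ⟨r, hr, rfl, rfl⟩
      exact ⟨rfl, by simp only [lay]; omega⟩
  rw [this, Finset.card_image_of_injOn, card_range]
  intro x hx y hy hxy
  simp only [coe_range, Set.mem_Iio] at hx hy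
  exact lay_inj (by omega) (by omega) (congrArg Prod.snd hxy)

theorem comb_and_tour_from_oddset_and_matching (h t m : ℕ)
    (hh : 1 ≤ h) (hht : h < t) (ht : 2 ≤ t) (hm : 6 ≤ m) (hme : Even m)
    (M : Finset (Sym2 (Fin m))) (hM : IsPerfectMatchingKm m M)
    (S : Finset (Fin m)) (hS5 : 5 ≤ S.card) (hSodd : Odd S.card)
    (w₁ w₂ w₃ w₄ : Fin m)
    (hw : w₁ ∈ S ∧ w₂ ∈ S ∧ w₃ ∈ S ∧ w₄ ∈ S)
    (hdist : w₁ ≠ w₂ ∧ w₁ ≠ w₃ ∧ w₁ ≠ w₄ ∧ w₂ ≠ w₃ ∧ w₂ ≠ w₄ ∧ w₃ ≠ w₄)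
    (h12 : s(w₁, w₂) ∈ M) (h34 : s(w₃, w₄) ∈ M) :
    ∃ (H : Finset (Fin m × Fin t)) (T : Fin (S.card - 2) → Finset (Fin m × Fin t)),
      IsUniformComb h t H T ∧
      ∃ (v : Fin m × Fin t) (C : (subPrism m t).Walk v v),
        C.IsHamiltonianCycle ∧
        ((C.edges.toFinset.filter (crossing H)).card : ℤ) +
            (∑ i, ((C.edges.toFinset.filter (crossing (T i))).card : ℤ)) -
            (3 * ((S.card : ℤ) - 2) + 1) =
          ((M.filter (crossing S)).card : ℤ) - 1 := by
  obtain ⟨u, rfl⟩ : ∃ u, t = u + 1 := ⟨t - 1, by omega⟩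
  obtain ⟨n, a, b, E, ha0, hb0, ha1, hb1, hMm, hMi⟩ := exists_enum M hM w₁ w₂ w₃ w₄ hdist h12 h34
  obtain ⟨hw1, hw2, hw3, hw4⟩ := hw
  obtain ⟨S', hS'⟩ : ∃ S' : Finset (Fin m), S' = (S.erase w₁).erase w₃ := ⟨_, rfl⟩
  have hS'm : ∀ c, c ∈ S' ↔ c ∈ S ∧ c ≠ w₁ ∧ c ≠ w₃ := by
    intro c; simp only [hS', Finset.mem_erase]; tauto
  have hS'c : S'.card = S.card - 2 := by
    rw [hS', Finset.card_erase_of_mem, Finset.card_erase_of_mem hw1]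
    · omega
    · exact Finset.mem_erase.2 ⟨hdist.2.1.symm, hw3⟩
  let σ := S'.orderEmbOfFin hS'c
  have hσ : ∀ i, σ i ∈ S' := fun i => Finset.orderEmbOfFin_mem S' hS'c i
  obtain ⟨H, hH⟩ : ∃ H : Finset (Fin m × Fin (u+1)), ∀ p, p ∈ H ↔ (p.1 ∈ S ∧ p.2.val < h) ∨ p.1 = w₁ ∨ p.1 = w₃ :=
    ⟨univ.filter fun p => (p.1 ∈ S ∧ p.2.val < h) ∨ p.1 = w₁ ∨ p.1 = w₃, by simp⟩
  obtain ⟨T, hT⟩ : ∃ T : Fin (S.card - 2) → Finset (Fin m × Fin (u+1)), ∀ i p, p ∈ T i ↔ p.1 = σ i :=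
    ⟨fun i => univ.filter fun p => p.1 = σ i, by simp⟩
  have hHT : ∀ i, (H ∩ T i).card = h := by
    intro i
    refine card_col (by omega) (σ i) _ fun p => ?_
    have h1 := (hS'm _).1 (hσ i)
    rw [Finset.mem_inter, hH, hT]
    constructor
    · rintro ⟨h2, h3⟩
      rw [h3] at h2
      tauto
    · rintro ⟨h2, h3⟩
      rw [h2]
      tauto
  refine ⟨H, T, ⟨⟨by omega, ?_, ?_, ?_, ?_⟩, ?_⟩, ?_⟩
  · exact Nat.Odd.sub_even (by omega) hSodd even_two
  · intro i j hij
    rw [Finset.disjoint_left]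
    intro p h1 h2
    rw [hT] at h1 h2
    exact hij (σ.injective (h1.symm.trans h2))
  · intro i
    rw [← Finset.card_pos, hHT i]
    omega
  · refine ⟨(w₁, lay u 0), ?_⟩
    rw [Finset.mem_sdiff, hH]
    refine ⟨Or.inr (Or.inl rfl), ?_⟩
    rw [Finset.mem_biUnion]
    rintro ⟨i, _, h1⟩
    rw [hT] at h1
    exact ((hS'm _).1 (hσ i)).2.1 h1.symm
  · intro i
    refine ⟨card_col le_rfl (σ i) _ fun p => ?_, hHT i⟩
    rw [hT]
    exact ⟨fun h => ⟨h, p.2.2⟩, fun h => h.1⟩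
  · obtain ⟨W, hW, hnd, hed⟩ := E.ham (u := u) (by omega)
    refine ⟨_, W, by convert hW, ?_⟩
    rw [card_cross H _ _ _ hed hnd,
      count_handle hh (by omega) E S S' w₁ w₃ hS'm hw1 hw3 hb0 ha1 H hH, card_matching M S a b hMm hMi]
    have : ∀ i, (W.edges.toFinset.filter (crossing (T i))).card = 2 := by
      intro i
      rw [card_cross (T i) _ _ _ hed hnd, count_col E (σ i) (T i) (hT i)]
    simp only [this, hS'c, Finset.sum_const, Finset.card_univ, Fintype.card_fin, nsmul_eq_mul]
    push_cast [Nat.cast_sub (show 2 ≤ S.card by omega)]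
    ring
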